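/- arXiv:2507.22230 — 2 statements merged into one kernel-verified Lean document; each statement's English description precedes it below -/
import Mathlib

section
/- Let (Y, ⪯, id, □, ⁻¹) satisfy axioms (O1), (O2) and (O3) below. If x, y ∈ Y admit a common upper bound z (i.e. x ⪯ z and y ⪯ z), then the least upper bound x ∨ y exists in Y. -/
noncomputable section

/-- The data of an ore together with axioms (O1), (O2) and (O3): a partial order `le`
with binary meets and bottom element `idY` (O1), a cancellative monoid structure `op`
with identity `idY` and involution `inv` (O2), such that `le x y` holds iff `y = op x z`
for some `z` (O3). -/
structure OreData (Y : Type) where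
  le : Y → Y → Prop
  idY : Y
  op : Y → Y → Y
  inv : Y → Y
  meet : Y → Y → Y
  le_refl : ∀ x, le x x
  le_antisymm : ∀ x y, le x y → le y x → x = y
  le_trans : ∀ x y z, le x y → le y z → le x z
  meet_le_left : ∀ x y, le (meet x y) x
  meet_le_right : ∀ x y, le (meet x y) y
  le_meet : ∀ x y z, le z x → le z y → le z (meet x y)
  id_le : ∀ x, le idY x
  op_assoc : ∀ x y z, op (op x y) z = op x (op y z)
  op_id : ∀ x, op x idY = x
  id_op : ∀ x, op idY x = x
  cancel_left : ∀ x y z, op x y = op x z → y = z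
  cancel_right : ∀ x y z, op x z = op y z → x = y
  inv_invol : ∀ x, inv (inv x) = x
  inv_op : ∀ x y, inv (op x y) = op (inv y) (inv x)
  le_iff : ∀ x y, le x y ↔ ∃ z, y = op x z

namespace OreData

variable {Y : Type} (O : OreData Y)

/-- An element is admissible if it is not of the form `x □ y □ y⁻¹ □ z` with `y ≠ id`. -/
def Admissible (f : Y) : Prop :=
  ¬ ∃ x y z : Y, y ≠ O.idY ∧ f = O.op (O.op (O.op x y) (O.inv y)) z

/-- `j` is the least upper bound of `x` and `y`. -/
def IsJoin (x y j : Y) : Prop :=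
  O.le x j ∧ O.le y j ∧ ∀ s, O.le x s → O.le y s → O.le j s

/-- `j` is the least upper bound of `x`, `y`, `z`. -/
def IsJoin3 (x y z j : Y) : Prop :=
  O.le x j ∧ O.le y j ∧ O.le z j ∧ ∀ s, O.le x s → O.le y s → O.le z s → O.le j s

/-- `j` is the least upper bound of `x`, `y`, `z` within the admissible elements. -/
def IsJoin3G (x y z j : Y) : Prop :=
  O.Admissible j ∧ O.le x j ∧ O.le y j ∧ O.le z j ∧
    ∀ s, O.Admissible s → O.le x s → O.le y s → O.le z s → O.le j s

/-- `x` and `y` are orthogonal: their meet is `id` and their join exists. -/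
def Orth (x y : Y) : Prop := O.meet x y = O.idY ∧ ∃ j, O.IsJoin x y j

/-- Axiom (O4): the admissible elements form a median semilattice. -/
def O4 : Prop :=
  ∀ a b c : Y, O.Admissible a → O.Admissible b → O.Admissible c →
    ∃ m : Y, O.IsJoin3G (O.meet a b) (O.meet b c) (O.meet a c) m ∧
      ∀ x : Y, O.Admissible x →
        O.IsJoin3G (O.meet x (O.meet a b)) (O.meet x (O.meet b c))
          (O.meet x (O.meet a c)) (O.meet x m)

/-- Axiom (O5). -/
def O5 : Prop :=
  ∀ x y y' : Y, O.Orth x y → O.Admissible x → O.Admissible y' →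
    O.IsJoin x y (O.op x y') → O.Admissible y

/-- Axiom (O6). -/
def O6 : Prop :=
  ∀ x y x' y' : Y, O.Admissible x → O.Admissible y → O.Orth x y →
    O.IsJoin x y (O.op x y') → O.IsJoin x y (O.op y x') →
    O.Admissible x' ∧ O.Admissible y' ∧
    O.Orth (O.inv x) y' ∧ O.Orth (O.inv y) x' ∧
    O.IsJoin (O.inv x) y' (O.op (O.inv x) y) ∧
    O.op (O.inv x) y = O.op y' (O.inv x') ∧
    O.IsJoin (O.inv y) x' (O.inv (O.op (O.inv x) y))

/-- `(Y, ⪯, id, □, ⁻¹)` is an ore: axioms (O1)–(O3) hold by the `OreData` structure and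
axioms (O4)–(O6) hold as well. -/
def IsOre : Prop := O.O4 ∧ O.O5 ∧ O.O6

open Classical in
/-- `y ∹ x`: the unique `z` with `y = x □ z` (if it exists; junk value otherwise). -/
def rdiv (y x : Y) : Y :=
  if h : ∃ z, y = O.op x z then h.choose else O.idY

open Classical in
/-- `y ∸ z`: the unique `x` with `y = x □ z` (if it exists; junk value otherwise). -/
def ldiv (y z : Y) : Y :=
  if h : ∃ x, y = O.op x z then h.choose else O.idY

/-- The star product `f ⋆ g = (f ∸ (f⁻¹ ∧ g)⁻¹) □ (g ∹ (f⁻¹ ∧ g))`. -/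
def star (f g : Y) : Y :=
  O.op (O.ldiv f (O.inv (O.meet (O.inv f) g))) (O.rdiv g (O.meet (O.inv f) g))

end OreData

namespace OreData

variable {Y : Type} (O : OreData Y)

theorem le_op (x y : Y) : O.le x (O.op x y) := (O.le_iff _ _).2 ⟨y, rfl⟩

theorem inv_idY : O.inv O.idY = O.idY := by
  have h := O.inv_op (O.inv O.idY) O.idY
  rw [O.op_id, O.inv_invol, O.op_id] at h
  exact h.symm

theorem eq_idY_of_op_le {m c : Y} (h : O.le (O.op m c) m) : c = O.idY := by
  have hm : O.op m c = O.op m O.idY := by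
    rw [O.op_id]
    exact O.le_antisymm _ _ h (O.le_op m c)
  exact O.cancel_left _ _ _ hm

/-- If `x □ p = y □ q` and `p`, `q` have no nontrivial common right factor, then `x □ p` is the
join of `x` and `y`. -/
theorem isJoin_op {x y p q : Y} (hpq : O.op x p = O.op y q)
    (hc : ∀ u v c : Y, p = O.op u c → q = O.op v c → c = O.idY) :
    O.IsJoin x y (O.op x p) := by
  refine ⟨O.le_op x p, hpq ▸ O.le_op y q, fun s hxs hys => ?_⟩
  set t := O.meet (O.op x p) s with ht
  obtain ⟨c, hc'⟩ := (O.le_iff _ _).1 (O.meet_le_left (O.op x p) s)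
  obtain ⟨u, hu⟩ := (O.le_iff _ _).1 (O.le_meet (O.op x p) s x (O.le_op x p) hxs)
  obtain ⟨v, hv⟩ := (O.le_iff _ _).1 (O.le_meet (O.op x p) s y (hpq ▸ O.le_op y q) hys)
  rw [← ht] at hc' hu hv
  have hp : p = O.op u c := by
    apply O.cancel_left x
    rw [← O.op_assoc, ← hu, hc']
  have hq : q = O.op v c := by
    apply O.cancel_left y
    rw [← O.op_assoc, ← hv, ← hpq, hc']
  rw [hc u v c hp hq, O.op_id] at hc'
  rw [hc']
  exact O.meet_le_right _ _

end OreData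

/-- If `(Y, ⪯, id, □, ⁻¹)` satisfies (O1), (O2) and (O3), and `x, y` have a common upper
bound, then the least upper bound `x ∨ y` exists. -/
theorem stmt10 {Y : Type} (O : OreData Y) (x y z : Y)
    (hx : O.le x z) (hy : O.le y z) : ∃ j : Y, O.IsJoin x y j := by
  obtain ⟨a, ha⟩ := (O.le_iff _ _).1 hx
  obtain ⟨b, hb⟩ := (O.le_iff _ _).1 hy
  set m := O.meet (O.inv a) (O.inv b) with hm
  obtain ⟨p, hp⟩ := (O.le_iff _ _).1 (O.meet_le_left (O.inv a) (O.inv b))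
  obtain ⟨q, hq⟩ := (O.le_iff _ _).1 (O.meet_le_right (O.inv a) (O.inv b))
  rw [← hm] at hp hq
  have ha' : a = O.op (O.inv p) (O.inv m) := by rw [← O.inv_op, ← hp, O.inv_invol]
  have hb' : b = O.op (O.inv q) (O.inv m) := by rw [← O.inv_op, ← hq, O.inv_invol]
  refine ⟨O.op x (O.inv p), O.isJoin_op (q := O.inv q) ?_ fun u v c hu hv => ?_⟩
  · apply O.cancel_right _ _ (O.inv m)
    rw [O.op_assoc, O.op_assoc, ← ha', ← hb', ← ha, hb]
  · have hpu : p = O.op (O.inv c) (O.inv u) := by rw [← O.inv_op, ← hu, O.inv_invol]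
    have hqv : q = O.op (O.inv c) (O.inv v) := by rw [← O.inv_op, ← hv, O.inv_invol]
    have hmc : O.le (O.op m (O.inv c)) m := by
      apply O.le_meet
      · rw [hp, hpu, ← O.op_assoc]
        exact O.le_op _ _
      · rw [hq, hqv, ← O.op_assoc]
        exact O.le_op _ _
    rw [← O.inv_invol c, O.eq_idY_of_op_le hmc, O.inv_idY]
end
end

section
/- Let (Y, ⪯, id, □, ⁻¹) be an ore with set of admissible elements G and star product ⋆. For a, b ∈ G define I(a,b) := {c ∈ G : (c⁻¹ ⋆ a) ∧ (c⁻¹ ⋆ b) = id} and m(a,b,c) := (a ∧ b) ∨ (b ∧ c) ∨ (a ∧ c). Then I(a,b) = {c ∈ G : m(a,b,c) = c}. Consequently, the action of G on itself by left ⋆-multiplication is median preserving: g ⋆ m(a,b,c) = m(g ⋆ a, g ⋆ b, g ⋆ c) for all g, a, b, c ∈ G. -/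
noncomputable section

open Classical in
/-- The join of three elements within the admissible elements (junk value if it does not
exist; it is unique when it exists, by antisymmetry). -/
def OreData.jn3 {Y : Type} (O : OreData Y) (x y z : Y) : Y :=
  if h : ∃ j, O.IsJoin3G x y z j then h.choose else O.idY

/-- The median `m(a,b,c) = (a ∧ b) ∨ (b ∧ c) ∨ (a ∧ c)`. -/
def OreData.med {Y : Type} (O : OreData Y) (a b c : Y) : Y :=
  O.jn3 (O.meet a b) (O.meet b c) (O.meet a c)

namespace OreData

section Theory

variable {Y : Type} (O : OreData Y)

local infixl:70 " ⊡ " => O.op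
local infix:50 " ≼ " => O.le
local postfix:max "ⁱ" => O.inv
local notation "𝟙₀" => O.idY

/-- Two elements are coprime when their only common left divisor is the identity. -/
def Cop (x y : Y) : Prop := ∀ r, r ≼ x → r ≼ y → r = 𝟙₀

/-- A commuting square `x □ y' = y □ x'` of admissible elements in which all four corners are
coprime. -/
structure Sq (x y x' y' : Y) : Prop where
  hx : O.Admissible x
  hy : O.Admissible y
  hx' : O.Admissible x'
  hy' : O.Admissible y'
  comm : x ⊡ y' = y ⊡ x'
  comm' : xⁱ ⊡ y = y' ⊡ x'ⁱ
  cop : O.Cop x y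
  cop_top : O.Cop x'ⁱ y'ⁱ
  cop_left : O.Cop xⁱ y'
  cop_right : O.Cop yⁱ x'

variable {O}

lemma Cop.symm {x y : Y} (h : O.Cop x y) : O.Cop y x := fun r h₁ h₂ => h r h₂ h₁

lemma le_op_s13 (x z : Y) : x ≼ x ⊡ z := (O.le_iff _ _).2 ⟨z, rfl⟩

lemma exists_of_le {x y : Y} (h : x ≼ y) : ∃ z, y = x ⊡ z := (O.le_iff _ _).1 h

lemma op_le_op_iff {a x y : Y} : a ⊡ x ≼ a ⊡ y ↔ x ≼ y := by
  rw [O.le_iff, O.le_iff]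
  constructor
  · rintro ⟨z, hz⟩
    exact ⟨z, O.cancel_left a _ _ (by rw [hz, O.op_assoc])⟩
  · rintro ⟨z, rfl⟩
    exact ⟨z, (O.op_assoc _ _ _).symm⟩

lemma eq_id_of_le {x : Y} (h : x ≼ 𝟙₀) : x = 𝟙₀ := O.le_antisymm _ _ h (O.id_le x)

lemma inv_id : 𝟙₀ⁱ = 𝟙₀ := by
  have h := O.inv_op 𝟙₀ⁱ 𝟙₀
  rwa [O.op_id, O.inv_invol, O.op_id, eq_comm] at h

lemma eq_id_of_inv {x : Y} (h : xⁱ = 𝟙₀) : x = 𝟙₀ := by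
  rw [← O.inv_invol x, h, inv_id]

lemma eq_id_of_op_le {x z : Y} (h : x ⊡ z ≼ x) : z = 𝟙₀ := by
  rw [← O.op_id x, O.op_assoc, O.id_op, op_le_op_iff] at h
  exact eq_id_of_le h

lemma Cop.mono {x y u v : Y} (h : O.Cop x y) (hu : u ≼ x) (hv : v ≼ y) : O.Cop u v :=
  fun r h₁ h₂ => h r (O.le_trans _ _ _ h₁ hu) (O.le_trans _ _ _ h₂ hv)

lemma cop_iff_meet {x y : Y} : O.Cop x y ↔ O.meet x y = 𝟙₀ := by
  constructor
  · intro h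
    exact h _ (O.meet_le_left _ _) (O.meet_le_right _ _)
  · intro h r h₁ h₂
    exact eq_id_of_le (h ▸ O.le_meet _ _ _ h₁ h₂)

/-- A common divisor of `c □ u` and `c □ v` divides `c` if `u` and `v` are coprime. -/
lemma Cop.le_of_le {c u v r : Y} (h : O.Cop u v) (hu : r ≼ c ⊡ u) (hv : r ≼ c ⊡ v) : r ≼ c := by
  obtain ⟨w, hw⟩ := exists_of_le (O.le_meet _ _ _ (le_op_s13 c u) (le_op_s13 c v))
  have hw' : w = 𝟙₀ := by
    apply h <;> rw [← op_le_op_iff (a := c), ← hw]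
    · exact O.meet_le_left _ _
    · exact O.meet_le_right _ _
  have := O.le_meet _ _ _ hu hv
  rwa [hw, hw', O.op_id] at this

lemma exists_meet_factor (x y : Y) :
    ∃ u v, x = O.meet x y ⊡ u ∧ y = O.meet x y ⊡ v ∧ O.Cop u v := by
  obtain ⟨u, hu⟩ := exists_of_le (O.meet_le_left x y)
  obtain ⟨v, hv⟩ := exists_of_le (O.meet_le_right x y)
  refine ⟨u, v, hu, hv, fun r h₁ h₂ => ?_⟩
  rw [← op_le_op_iff (a := O.meet x y), ← hu] at h₁
  rw [← op_le_op_iff (a := O.meet x y), ← hv] at h₂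
  exact eq_id_of_op_le (O.le_meet _ _ _ h₁ h₂)

lemma meet_op_op {k u v : Y} (h : O.Cop u v) : O.meet (k ⊡ u) (k ⊡ v) = k :=
  O.le_antisymm _ _ (h.le_of_le (O.meet_le_left _ _) (O.meet_le_right _ _))
    (O.le_meet _ _ _ (le_op_s13 _ _) (le_op_s13 _ _))

lemma meet_comm (x y : Y) : O.meet x y = O.meet y x :=
  O.le_antisymm _ _ (O.le_meet _ _ _ (O.meet_le_right _ _) (O.meet_le_left _ _))
    (O.le_meet _ _ _ (O.meet_le_right _ _) (O.meet_le_left _ _))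

/-! ### Admissible elements -/

lemma Admissible.of_le {x y : Y} (h : O.Admissible y) (hxy : x ≼ y) : O.Admissible x := by
  obtain ⟨z, rfl⟩ := exists_of_le hxy
  rintro ⟨a, b, c, hb, rfl⟩
  exact h ⟨a, b, c ⊡ z, hb, by simp only [O.op_assoc]⟩

lemma Admissible.left {x y : Y} (h : O.Admissible (x ⊡ y)) : O.Admissible x := h.of_le (le_op_s13 _ _)

lemma Admissible.right {x y : Y} (h : O.Admissible (x ⊡ y)) : O.Admissible y := by
  rintro ⟨a, b, c, hb, rfl⟩
  exact h ⟨x ⊡ a, b, c, hb, by simp only [O.op_assoc]⟩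

lemma Admissible.inv {x : Y} (h : O.Admissible x) : O.Admissible xⁱ := by
  rintro ⟨a, b, c, hb, hx⟩
  refine h ⟨cⁱ, b, aⁱ, hb, ?_⟩
  rw [← O.inv_invol x, hx]
  simp only [O.op_assoc, O.inv_op, O.inv_invol]

lemma Admissible.cop {x y : Y} (h : O.Admissible (x ⊡ y)) : O.Cop xⁱ y := by
  intro r h₁ h₂
  obtain ⟨u, hu⟩ := exists_of_le h₁
  obtain ⟨v, rfl⟩ := exists_of_le h₂
  by_contra hr
  refine h ⟨uⁱ, rⁱ, v, fun h => hr (eq_id_of_inv h), ?_⟩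
  rw [← O.inv_invol x, hu]
  simp only [O.op_assoc, O.inv_op, O.inv_invol]

/-- Admissibility can be tested on factorizations `f = s □ t`. -/
lemma admissible_of_cop {f : Y} (h : ∀ s t, f = s ⊡ t → O.Cop sⁱ t) : O.Admissible f := by
  rintro ⟨a, b, c, hb, hf⟩
  refine hb (eq_id_of_inv (h (a ⊡ b) (bⁱ ⊡ c) (by rw [hf, O.op_assoc]) _ ?_ (le_op_s13 _ _)))
  rw [O.inv_op]
  exact le_op_s13 _ _

/-! ### Joins -/

lemma isJoin_of_cop {x y x' y' : Y} (h : x ⊡ y' = y ⊡ x') (hc : O.Cop x'ⁱ y'ⁱ) :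
    O.IsJoin x y (x ⊡ y') := by
  refine ⟨le_op_s13 _ _, h ▸ le_op_s13 _ _, fun s hx hy => ?_⟩
  obtain ⟨p, hp⟩ := exists_of_le (O.le_meet _ _ _ (le_op_s13 x y') hx)
  obtain ⟨q, hq⟩ := exists_of_le (O.le_meet _ _ _ (h ▸ le_op_s13 y x' : y ≼ x ⊡ y') hy)
  obtain ⟨d, hd⟩ := exists_of_le (O.meet_le_left (x ⊡ y') s)
  have hy' : y' = p ⊡ d := O.cancel_left x _ _ (by rw [← O.op_assoc, ← hp, ← hd])
  have hx' : x' = q ⊡ d := O.cancel_left y _ _ (by rw [← O.op_assoc, ← hq, ← hd, h])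
  have : d = 𝟙₀ := by
    apply eq_id_of_inv
    apply hc
    · rw [hx', O.inv_op]; exact le_op_s13 _ _
    · rw [hy', O.inv_op]; exact le_op_s13 _ _
  rw [this, O.op_id] at hd
  rw [hd]
  exact O.meet_le_right _ _

lemma cop_of_isJoin {x y x' y' : Y} (h : x ⊡ y' = y ⊡ x') (hj : O.IsJoin x y (x ⊡ y')) :
    O.Cop x'ⁱ y'ⁱ := by
  intro r h₁ h₂
  obtain ⟨p, hp⟩ := exists_of_le h₁
  obtain ⟨q, hq⟩ := exists_of_le h₂
  have hx' : x' = pⁱ ⊡ rⁱ := by rw [← O.inv_op, ← hp, O.inv_invol]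
  have hy' : y' = qⁱ ⊡ rⁱ := by rw [← O.inv_op, ← hq, O.inv_invol]
  have hpq : x ⊡ qⁱ = y ⊡ pⁱ := O.cancel_right _ _ rⁱ (by
    rw [O.op_assoc, O.op_assoc, ← hx', ← hy', h])
  have := hj.2.2 (x ⊡ qⁱ) (le_op_s13 _ _) (hpq ▸ le_op_s13 _ _)
  rw [hy', ← O.op_assoc] at this
  exact eq_id_of_inv (eq_id_of_op_le this)

lemma IsJoin.unique {x y j k : Y} (hj : O.IsJoin x y j) (hk : O.IsJoin x y k) : j = k :=
  O.le_antisymm _ _ (hj.2.2 _ hk.1 hk.2.1) (hk.2.2 _ hj.1 hj.2.1)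

/-- Two elements with a common upper bound have a join. -/
lemma exists_join_factor {a b c d : Y} (h : a ⊡ b = c ⊡ d) :
    ∃ b' d' e, b = b' ⊡ e ∧ d = d' ⊡ e ∧ a ⊡ b' = c ⊡ d' ∧ O.Cop d'ⁱ b'ⁱ := by
  obtain ⟨u, v, hu, hv, hc⟩ := exists_meet_factor (O := O) bⁱ dⁱ
  set e := O.meet bⁱ dⁱ
  have hb : b = uⁱ ⊡ eⁱ := by rw [← O.inv_op, ← hu, O.inv_invol]
  have hd : d = vⁱ ⊡ eⁱ := by rw [← O.inv_op, ← hv, O.inv_invol]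
  refine ⟨uⁱ, vⁱ, eⁱ, hb, hd, ?_, ?_⟩
  · apply O.cancel_right _ _ eⁱ
    rw [O.op_assoc, O.op_assoc, ← hb, ← hd, h]
  · rw [O.inv_invol, O.inv_invol]; exact hc.symm

/-! ### Squares -/

namespace Sq

lemma symm {x y x' y' : Y} (h : O.Sq x y x' y') : O.Sq y x y' x' where
  hx := h.hy
  hy := h.hx
  hx' := h.hy'
  hy' := h.hx'
  comm := h.comm.symm
  comm' := by
    have := congrArg O.inv h.comm'
    simpa only [O.inv_op, O.inv_invol] using this
  cop := h.cop.symm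
  cop_top := h.cop_top.symm
  cop_left := h.cop_right
  cop_right := h.cop_left

lemma flip {x y x' y' : Y} (h : O.Sq x y x' y') : O.Sq xⁱ y' x'ⁱ y where
  hx := h.hx.inv
  hy := h.hy'
  hx' := h.hx'.inv
  hy' := h.hy
  comm := h.comm'
  comm' := by rw [O.inv_invol, O.inv_invol, h.comm]
  cop := h.cop_left
  cop_top := by rw [O.inv_invol]; exact h.cop_right.symm
  cop_left := by rw [O.inv_invol]; exact h.cop
  cop_right := h.cop_top.symm

lemma rotate {x y x' y' : Y} (h : O.Sq x y x' y') : O.Sq x'ⁱ y'ⁱ xⁱ yⁱ :=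
  h.symm.flip.symm.flip

lemma isJoin {x y x' y' : Y} (h : O.Sq x y x' y') : O.IsJoin x y (x ⊡ y') :=
  isJoin_of_cop h.comm h.cop_top

lemma of_isJoin (hO : O.IsOre) {x y x' y' : Y} (hx : O.Admissible x) (hy : O.Admissible y)
    (h : x ⊡ y' = y ⊡ x') (hc : O.Cop x y) (hj : O.IsJoin x y (x ⊡ y')) : O.Sq x y x' y' := by
  obtain ⟨h₁, h₂, h₃, h₄, -, h₆, -⟩ :=
    hO.2.2 x y x' y' hx hy ⟨cop_iff_meet.1 hc, _, hj⟩ hj (h ▸ hj)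
  exact ⟨hx, hy, h₁, h₂, h, h₆, hc, cop_of_isJoin h hj, cop_iff_meet.2 h₃.1, cop_iff_meet.2 h₄.1⟩

lemma of_cop (hO : O.IsOre) {x y x' y' : Y} (hx : O.Admissible x) (hy : O.Admissible y)
    (h : x ⊡ y' = y ⊡ x') (hc : O.Cop x y) (ht : O.Cop x'ⁱ y'ⁱ) : O.Sq x y x' y' :=
  of_isJoin hO hx hy h hc (isJoin_of_cop h ht)

lemma of_cop' (hO : O.IsOre) {x y x' y' : Y} (hx : O.Admissible x) (hy' : O.Admissible y')
    (h : x ⊡ y' = y ⊡ x') (hc : O.Cop x y) (ht : O.Cop x'ⁱ y'ⁱ) : O.Sq x y x' y' :=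
  of_cop hO hx (hO.2.1 x y y' ⟨cop_iff_meet.1 hc, _, isJoin_of_cop h ht⟩ hx hy'
    (isJoin_of_cop h ht)) h hc ht

lemma unique {x y z x' x'' y' : Y} (h : O.Sq x y x' y') (h' : O.Sq x z x'' y') :
    y = z ∧ x' = x'' := by
  have hyz : y = z := O.cancel_left xⁱ _ _ (h.flip.isJoin.unique h'.flip.isJoin)
  subst hyz
  exact ⟨rfl, O.cancel_left y _ _ (h.comm.symm.trans h'.comm)⟩

lemma eq_id_of_right {x y x' y' : Y} (h : O.Sq x y x' y') (hy' : y' = 𝟙₀) : y = 𝟙₀ := by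
  refine h.cop _ ?_ (O.le_refl _)
  have := h.comm
  rw [hy', O.op_id] at this
  rw [this]
  exact le_op_s13 _ _

/-- A divisor of a side which is not the common corner can be moved across. -/
lemma exists_left (hO : O.IsOre) {x y x' y' y₁ : Y} (h : O.Sq x y x' y') (hy : y₁ ≼ y) :
    ∃ x₁ y₁', O.Sq x y₁ x₁ y₁' ∧ y₁' ≼ y' := by
  obtain ⟨y₂, rfl⟩ := exists_of_le hy
  obtain ⟨y₁', x₁, e, rfl, -, hc, ht⟩ :=
    exists_join_factor (h.comm.trans (O.op_assoc _ _ _))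
  exact ⟨x₁, y₁', of_cop hO h.hx h.hy.left hc (h.cop.mono (O.le_refl _) hy) ht, le_op_s13 _ _⟩

lemma split (hO : O.IsOre) {x y₁ y₂ x' y' : Y} (h : O.Sq x (y₁ ⊡ y₂) x' y') :
    ∃ x₁ y₁' y₂', y' = y₁' ⊡ y₂' ∧ O.Sq x y₁ x₁ y₁' ∧ O.Sq x₁ y₂ x' y₂' := by
  obtain ⟨y₁', x₁, y₂', rfl, hx, hc, ht⟩ :=
    exists_join_factor (h.comm.trans (O.op_assoc _ _ _))
  have h₁ : O.Sq x y₁ x₁ y₁' :=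
    of_cop hO h.hx h.hy.left hc (h.cop.mono (O.le_refl _) (le_op_s13 _ _)) ht
  refine ⟨x₁, y₁', y₂', rfl, h₁, of_cop hO h₁.hx' h.hy.right hx.symm (fun q hq₁ hq₂ => ?_)
    (h.cop_top.mono (O.le_refl _) ?_)⟩
  · obtain ⟨u, q₀, hq, hq₀⟩ := h₁.symm.flip.exists_left hO hq₁
    have hq₀' : q₀ = 𝟙₀ := by
      refine h.cop _ hq₀ (O.le_trans _ (y₁ ⊡ q) _ ?_ (op_le_op_iff.2 hq₂))
      have := hq.flip.comm
      rw [O.inv_invol] at this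
      rw [this]
      exact le_op_s13 _ _
    exact hq.eq_id_of_right hq₀'
  · rw [O.inv_op]; exact le_op_s13 _ _

/-- An element below the join of a square and coprime to one side divides the other side. -/
lemma le_of_cop (hO : O.IsOre) {x y x' y' r : Y} (h : O.Sq x y x' y') (hr : r ≼ x ⊡ y')
    (hc : O.Cop x r) : r ≼ y := by
  obtain ⟨t, ht⟩ := exists_of_le hr
  obtain ⟨y₁', x₁, e, rfl, -, hcomm, htop⟩ := exists_join_factor ht
  have h₁ : O.Sq x r x₁ y₁' := of_cop' hO h.hx h.hy'.left hcomm hc htop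
  obtain ⟨x₂, y₁, h₂, hy₁⟩ := h.flip.exists_left hO (le_op_s13 y₁' e)
  have h₃ := h₂.flip
  rw [O.inv_invol] at h₃
  rw [(h₁.unique h₃).1]
  exact hy₁

lemma cop_side {b c b' c' r H : Y} (h : O.Sq b c b' c') (hc : O.Cop b' H) (hb : r ≼ b)
    (hr : r ≼ c ⊡ H) : r = 𝟙₀ :=
  h.cop _ hb (hc.le_of_le (h.comm ▸ O.le_trans _ _ _ hb (le_op_s13 _ _)) hr)

end Sq

/-- The refinement property for factorizations of a product of two admissible elements. -/
lemma exists_refinement (hO : O.IsOre) {a b c d : Y} (ha : O.Admissible a) (hb : O.Admissible b)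
    (h : a ⊡ b = c ⊡ d) :
    ∃ k p w v t e, a = k ⊡ p ∧ c = k ⊡ w ∧ b = v ⊡ e ∧ d = t ⊡ e ∧ O.Sq p w t v := by
  obtain ⟨p, w, hp, hw, hc⟩ := exists_meet_factor (O := O) a c
  set k := O.meet a c
  have hk : p ⊡ b = w ⊡ d := O.cancel_left k _ _ (by
    rw [← O.op_assoc, ← O.op_assoc, ← hp, ← hw, h])
  obtain ⟨v, t, e, hv, ht, hcomm, htop⟩ := exists_join_factor hk
  refine ⟨k, p, w, v, t, e, hp, hw, hv, ht, Sq.of_cop' hO ?_ ?_ hcomm hc htop⟩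
  · exact (hp ▸ ha : O.Admissible (k ⊡ p)).right
  · exact (hv ▸ hb : O.Admissible (v ⊡ e)).left

/-- The join of two orthogonal admissible elements is admissible. -/
lemma Sq.admissible (hO : O.IsOre) {x y x' y' : Y} (h : O.Sq x y x' y') :
    O.Admissible (x ⊡ y') := by
  refine admissible_of_cop fun s t hst r hrs hrt => ?_
  obtain ⟨k, p, w, v, t', e, rfl, rfl, rfl, rfl, hS⟩ :=
    exists_refinement hO h.hx h.hy' hst
  obtain ⟨x₁, y₁, y₂, rfl, h₁, h₂⟩ := h.flip.split hO
  have h₁' := h₁.flip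
  have h₂' := h₂.flip
  rw [O.inv_invol] at h₁' h₂'
  obtain ⟨q, k₁, p₁, hx₁, h₃, h₄⟩ := h₁'.symm.split hO
  obtain ⟨rfl, rfl⟩ := hS.unique h₄.symm
  rw [hx₁] at h₂'
  obtain ⟨y₃, k₂, p₂, -, h₅, h₆⟩ := h₂'.symm.split hO
  -- `h₃`, `h₄`, `h₅`, `h₆` form a two by two grid of squares
  have hw : ∀ z, z ≼ wⁱ → z ≼ t' ⊡ e → z = 𝟙₀ := fun z hz₁ hz₂ =>
    hS.symm.flip.cop_side h.hy'.cop hz₁ hz₂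
  have ht : ∀ z, z ≼ t' → z ≼ wⁱ ⊡ kⁱ → z = 𝟙₀ := fun z hz₁ hz₂ =>
    hS.symm.flip.symm.cop_side h.hx.cop.symm hz₁ hz₂
  rw [O.inv_op] at hrs
  have hk : r ≼ k₁ⁱ := by
    refine h₃.rotate.le_of_cop hO hrs fun z hz₁ hz₂ => hw z hz₁ (O.le_trans _ _ _ hz₂ hrt)
  have hy₃ : r ≼ y₃ :=
    h₆.symm.le_of_cop hO hrt fun z hz₁ hz₂ => ht z hz₁ (O.le_trans _ _ _ hz₂ hrs)
  exact h₅.cop_right _ hk hy₃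

/-- Two sides of squares at a vertex are coprime at the opposite ends of the third edge. -/
lemma Sq.cop_of_cop (hO : O.IsOre) {a b c ab ba ac ca : Y} (h₁ : O.Sq a b ab ba)
    (h₂ : O.Sq a c ac ca) (h : O.Cop b c) : O.Cop ba ca := by
  intro q hq₁ hq₂
  obtain ⟨_, b', hb, hb'⟩ := h₁.flip.exists_left hO hq₁
  obtain ⟨_, c', hc, hc'⟩ := h₂.flip.exists_left hO hq₂
  have hb := hb.flip
  have hc := hc.flip
  rw [O.inv_invol] at hb hc
  have hbc := (hb.unique hc).1
  exact hb.flip.eq_id_of_right (h _ hb' (hbc ▸ hc'))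

/-- Three pairwise orthogonal admissible elements span a cube. -/
lemma Sq.exists_cube (hO : O.IsOre) {a b c ab ba ac ca bc cb : Y} (h₁ : O.Sq a b ab ba)
    (h₂ : O.Sq a c ac ca) (h₃ : O.Sq b c bc cb) :
    ∃ α β γ, O.Sq ba ca β γ ∧ O.Sq ab cb α γ ∧ O.Sq ac bc α β := by
  obtain ⟨m, ⟨hm, hm₁, hm₂, hm₃, -⟩, -⟩ :=
    hO.1 _ _ _ (h₁.admissible hO) (h₃.admissible hO) (h₂.admissible hO)
  have hbm : b ≼ m :=
    O.le_trans _ _ _ (O.le_meet _ _ _ h₁.isJoin.2.1 h₃.isJoin.1) hm₁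
  have hcm : c ≼ m :=
    O.le_trans _ _ _ (O.le_meet _ _ _ h₃.isJoin.2.1 h₂.isJoin.2.1) hm₂
  have ham : a ≼ m :=
    O.le_trans _ _ _ (O.le_meet _ _ _ h₁.isJoin.1 h₂.isJoin.1) hm₃
  obtain ⟨u, hu⟩ := exists_of_le (h₁.isJoin.2.2 m ham hbm)
  obtain ⟨v, hv⟩ := exists_of_le hcm
  obtain ⟨γ, v', e, rfl, -, hγ, hcop⟩ := exists_join_factor (hu.symm.trans hv)
  have hN := isJoin_of_cop hγ hcop
  set N := a ⊡ ba ⊡ γ with hNγ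
  have hNad : O.Admissible N := hm.of_le (hu ▸ op_le_op_iff.2 (le_op_s13 _ _))
  have ha : a ≼ N := O.le_trans _ _ _ h₁.isJoin.1 hN.1
  have hb : b ≼ N := O.le_trans _ _ _ h₁.isJoin.2.1 hN.1
  have hc : c ≼ N := hN.2.1
  have hlub : ∀ s, a ≼ s → b ≼ s → c ≼ s → N ≼ s := fun s has hbs hcs =>
    hN.2.2 s (h₁.isJoin.2.2 s has hbs) hcs
  obtain ⟨β, hβ⟩ := exists_of_le (h₂.isJoin.2.2 N ha hc)
  obtain ⟨α, hα⟩ := exists_of_le (h₃.isJoin.2.2 N hb hc)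
  have face : ∀ x y z p q r s γ' β', x ≼ N → O.Sq x y p q → O.Sq x z r s → O.Cop y z →
      N = x ⊡ q ⊡ γ' → N = x ⊡ s ⊡ β' →
      (∀ t, x ≼ t → y ≼ t → z ≼ t → N ≼ t) → O.Sq q s β' γ' := by
    intro x y z p q r s γ' β' hx hy hz hyz hγ' hβ' hl
    have hcomm : q ⊡ γ' = s ⊡ β' := O.cancel_left x _ _ (by
      rw [← O.op_assoc, ← O.op_assoc, ← hγ', hβ'])
    refine Sq.of_isJoin hO hy.hy' hz.hy' hcomm (hy.cop_of_cop hO hz hyz)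
      ⟨le_op_s13 _ _, hcomm ▸ le_op_s13 _ _, fun t hq hs => ?_⟩
    rw [← op_le_op_iff (a := x), ← O.op_assoc, ← hγ']
    refine hl _ (le_op_s13 _ _) (O.le_trans _ _ _ hy.isJoin.2.1 (op_le_op_iff.2 hq))
      (O.le_trans _ _ _ hz.isJoin.2.1 (op_le_op_iff.2 hs))
  refine ⟨α, β, γ, face a b c _ _ _ _ γ β ha h₁ h₂ h₃.cop hNγ hβ hlub,
    face b a c _ _ _ _ γ α hb h₁.symm h₃ h₂.cop ?_ hα fun s hs₁ hs₂ => hlub s hs₂ hs₁,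
    face c a b _ _ _ _ β α hc h₂.symm h₃.symm h₁.cop ?_ ?_ fun s hs₁ hs₂ hs₃ => hlub s hs₂ hs₃ hs₁⟩
  · rw [← h₁.comm]
  · rw [← h₂.comm, hβ]
  · rw [← h₃.comm, hα]

/-- If `z` divides both extensions of the sides `b`, `c` of a square, then `z` spans a cube with
this square, and it can be transported to the opposite corner as `R`. -/
lemma Sq.exists_transport (hO : O.IsOre) {b c bc cb F H z : Y} (h : O.Sq b c bc cb)
    (hF : O.Admissible F) (hH : O.Admissible H) (hcF : O.Cop cb F) (hcH : O.Cop bc H)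
    (hzF : z ≼ b ⊡ F) (hzH : z ≼ c ⊡ H) :
    ∃ d F' e H' R U V β γ, F = d ⊡ F' ∧ H = e ⊡ H' ∧ b ⊡ d = z ⊡ U ∧ c ⊡ e = z ⊡ V ∧
      cbⁱ ⊡ d = R ⊡ γⁱ ∧ bcⁱ ⊡ e = R ⊡ βⁱ ∧ Uⁱ ⊡ V = γ ⊡ βⁱ ∧ (R = 𝟙₀ → z = 𝟙₀) := by
  have hzb : O.Cop z b := fun r hr₁ hr₂ =>
    h.cop_side hcH hr₂ (O.le_trans _ _ _ hr₁ hzH)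
  have hzc : O.Cop z c := fun r hr₁ hr₂ =>
    h.symm.cop_side hcF hr₂ (O.le_trans _ _ _ hr₁ hzF)
  obtain ⟨F₀, hF₀⟩ := exists_of_le hzF
  obtain ⟨H₀, hH₀⟩ := exists_of_le hzH
  obtain ⟨d, zb, F', rfl, -, hbz, hbt⟩ := exists_join_factor hF₀
  obtain ⟨e, zc, H', rfl, -, hcz, hct⟩ := exists_join_factor hH₀
  have h₁ : O.Sq z b d zb := (Sq.of_cop' hO h.hx hF.left hbz hzb.symm hbt).symm
  have h₂ : O.Sq z c e zc := (Sq.of_cop' hO h.hy hH.left hcz hzc.symm hct).symm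
  obtain ⟨α, β, γ, hA, hB, hC⟩ := h₁.exists_cube hO h₂ h
  refine ⟨d, F', e, H', α, zb, zc, β, γ, rfl, rfl, hbz, hcz, hB.symm.comm', hC.symm.comm',
    hA.comm', fun hα => ?_⟩
  exact h₁.symm.eq_id_of_right (hB.symm.eq_id_of_right hα)

/-- The product of admissible elements without cancellation is admissible. -/
lemma Cop.admissible (hO : O.IsOre) {u v : Y} (hu : O.Admissible u) (hv : O.Admissible v)
    (h : O.Cop uⁱ v) : O.Admissible (u ⊡ v) := by
  refine admissible_of_cop fun s t hst r hrs hrt => ?_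
  obtain ⟨k, p, w, v, t', e, rfl, rfl, rfl, rfl, hS⟩ := exists_refinement hO hu hv hst
  rw [O.inv_op] at hrs
  obtain ⟨d, F', e', H', R, U, V, β, γ, hF, hH, -, -, h₁, h₂, -, hR⟩ :=
    hS.symm.flip.exists_transport hO hu.left.inv hv.right hu.cop.symm hv.cop hrs hrt
  refine hR (h R ?_ ?_)
  · rw [O.inv_op, hF, ← O.op_assoc, h₁, O.op_assoc]
    exact le_op_s13 _ _
  · rw [O.inv_invol] at h₂
    rw [hH, ← O.op_assoc, h₂, O.op_assoc]
    exact le_op_s13 _ _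

/-! ### The star product -/

lemma rdiv_op (x z : Y) : O.rdiv (x ⊡ z) x = z := by
  have h : ∃ w, x ⊡ z = x ⊡ w := ⟨z, rfl⟩
  rw [rdiv, dif_pos h]
  exact (O.cancel_left _ _ _ h.choose_spec).symm

lemma ldiv_op (x z : Y) : O.ldiv (x ⊡ z) z = x := by
  have h : ∃ w, x ⊡ z = w ⊡ z := ⟨x, rfl⟩
  rw [ldiv, dif_pos h]
  exact (O.cancel_right _ _ _ h.choose_spec).symm

/-- The star product cancels common divisors. -/
lemma star_of_cop {c u v : Y} (h : O.Cop uⁱ v) : O.star (u ⊡ cⁱ) (c ⊡ v) = u ⊡ v := by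
  have hm : O.meet (u ⊡ cⁱ)ⁱ (c ⊡ v) = c := by
    rw [O.inv_op, O.inv_invol]
    exact meet_op_op h
  rw [star, hm, rdiv_op, ldiv_op]

lemma exists_star_factor (f g : Y) :
    ∃ u c v, f = u ⊡ cⁱ ∧ g = c ⊡ v ∧ O.Cop uⁱ v ∧ O.star f g = u ⊡ v := by
  obtain ⟨u, v, hu, hv, hc⟩ := exists_meet_factor (O := O) fⁱ g
  have hf : f = uⁱ ⊡ (O.meet fⁱ g)ⁱ := by rw [← O.inv_op, ← hu, O.inv_invol]
  have hc' : O.Cop uⁱⁱ v := by rwa [O.inv_invol]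
  refine ⟨uⁱ, O.meet fⁱ g, v, hf, hv, hc', ?_⟩
  conv_lhs => rw [hf]; arg 3; rw [hv]
  exact star_of_cop hc'

lemma star_cancel (u c v : Y) : O.star (u ⊡ cⁱ) (c ⊡ v) = O.star u v := by
  obtain ⟨u', k, v', rfl, rfl, hc, h⟩ := exists_star_factor (O := O) u v
  rw [h, O.op_assoc, ← O.inv_op, ← O.op_assoc, star_of_cop hc]

lemma star_of_admissible {u v : Y} (h : O.Admissible (u ⊡ v)) : O.star u v = u ⊡ v := by
  have := star_of_cop (c := 𝟙₀) h.cop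
  rwa [star_cancel] at this

lemma Admissible.star (hO : O.IsOre) {f g : Y} (hf : O.Admissible f) (hg : O.Admissible g) :
    O.Admissible (O.star f g) := by
  obtain ⟨u, c, v, rfl, rfl, hc, h⟩ := exists_star_factor (O := O) f g
  rw [h]
  exact hc.admissible hO hf.left hg.right

lemma inv_star (f g : Y) : (O.star f g)ⁱ = O.star gⁱ fⁱ := by
  obtain ⟨u, c, v, rfl, rfl, hc, h⟩ := exists_star_factor (O := O) f g
  rw [h, O.inv_op, O.inv_op, O.inv_op, O.inv_invol, star_of_cop]
  rw [O.inv_invol]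
  exact hc.symm

lemma star_inv_self (g : Y) : O.star gⁱ g = 𝟙₀ := by
  have := star_of_cop (O := O) (c := g) (u := 𝟙₀) (v := 𝟙₀) fun r _ h => eq_id_of_le h
  rwa [O.id_op, O.op_id, O.op_id] at this

lemma id_star (g : Y) : O.star 𝟙₀ g = g := by
  have := star_of_cop (O := O) (c := 𝟙₀) (u := 𝟙₀) (v := g) fun r h _ =>
    eq_id_of_le (inv_id (O := O) ▸ h)
  rwa [O.id_op, O.id_op, inv_id] at this

/-- The star product does not change when the two sides of a square are exchanged. -/
lemma Sq.star_eq (hO : O.IsOre) {x y x' y' f h : Y} (hS : O.Sq x y x' y')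
    (hfx : O.Admissible (f ⊡ x)) (hfy : O.Admissible (f ⊡ y)) (hx : O.Admissible (x' ⊡ h))
    (hy : O.Admissible (y' ⊡ h)) : O.star (f ⊡ y) (x' ⊡ h) = O.star (f ⊡ x) (y' ⊡ h) := by
  have hS' : O.Sq yⁱ x' y'ⁱ x := hS.symm.flip
  obtain ⟨d, F, e, h, R, U, V, β, γ, hF, rfl, hU, hV, hγ, hβ, hUV, -⟩ :=
    hS'.exists_transport hO (z := O.meet (f ⊡ y)ⁱ (x' ⊡ h)) hfx.left.inv hx.right hfx.cop.symm
      hy.cop (O.inv_op f y ▸ O.meet_le_left _ _) (O.meet_le_right _ _)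
  set z := O.meet (f ⊡ y)ⁱ (x' ⊡ (e ⊡ h))
  have hf : f = Fⁱ ⊡ dⁱ := by rw [← O.inv_op, ← hF, O.inv_invol]
  have e₁ : f ⊡ y = Fⁱ ⊡ Uⁱ ⊡ zⁱ := by
    rw [hf, O.op_assoc, O.op_assoc, ← O.inv_op, ← hU, O.inv_op, O.inv_invol]
  have e₂ : x' ⊡ (e ⊡ h) = z ⊡ (V ⊡ h) := by rw [← O.op_assoc, hV, O.op_assoc]
  have e₃ : f ⊡ x = Fⁱ ⊡ γ ⊡ Rⁱ := by
    have := congrArg O.inv hγ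
    rw [O.inv_op, O.inv_op, O.inv_invol, O.inv_invol] at this
    rw [hf, O.op_assoc, O.op_assoc, this]
  have e₄ : y' ⊡ (e ⊡ h) = R ⊡ (βⁱ ⊡ h) := by
    rw [O.inv_invol] at hβ
    rw [← O.op_assoc, hβ, O.op_assoc]
  obtain ⟨u, v, hu, hv, hc⟩ := exists_meet_factor (O := O) (f ⊡ y)ⁱ (x' ⊡ (e ⊡ h))
  have hu' : u = U ⊡ F := O.cancel_left z _ _ (by
    rw [← hu, e₁]; simp only [O.inv_op, O.inv_invol, O.op_assoc])
  have hv' : v = V ⊡ h := O.cancel_left z _ _ (by rw [← hv, e₂])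
  have hcop : O.Cop (Fⁱ ⊡ Uⁱ)ⁱ (V ⊡ h) := by
    rw [O.inv_op, O.inv_invol, O.inv_invol, ← hu', ← hv']; exact hc
  have hadm := hcop.admissible hO (e₁ ▸ hfy).left (e₂ ▸ hx).right
  have heq : Fⁱ ⊡ Uⁱ ⊡ (V ⊡ h) = Fⁱ ⊡ γ ⊡ (βⁱ ⊡ h) := by
    rw [O.op_assoc, ← O.op_assoc Uⁱ, hUV]; simp only [O.op_assoc]
  rw [e₁, e₂, e₃, e₄, star_of_cop hcop, star_cancel, heq, star_of_admissible (heq ▸ hadm)]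

lemma star_assoc (hO : O.IsOre) {f g h : Y} (hf : O.Admissible f) (hg : O.Admissible g)
    (hh : O.Admissible h) : O.star (O.star f g) h = O.star f (O.star g h) := by
  have hfg := hf.star hO hg
  have hgh := hg.star hO hh
  obtain ⟨f₀, c, g₀, rfl, rfl, hc, e₁⟩ := exists_star_factor (O := O) f g
  obtain ⟨g₁, k, h₁, hg₁, rfl, hc', e₂⟩ := exists_star_factor (O := O) (c ⊡ g₀) h
  rw [e₁] at hfg ⊢
  rw [e₂] at hgh ⊢
  obtain ⟨a, p, w, v, t, e, rfl, rfl, rfl, hk, hS⟩ :=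
    exists_refinement hO hg.left hg.right hg₁
  have hk' : k = eⁱ ⊡ tⁱ := by rw [← O.inv_op, ← hk, O.inv_invol]
  subst hk'
  have hS' : O.Sq pⁱ v tⁱ w := hS.flip
  have e₃ : f₀ ⊡ (v ⊡ e) = f₀ ⊡ v ⊡ eⁱⁱ := by rw [O.inv_invol, O.op_assoc]
  have e₄ : eⁱ ⊡ tⁱ ⊡ h₁ = eⁱ ⊡ (tⁱ ⊡ h₁) := O.op_assoc _ _ _
  have e₅ : f₀ ⊡ (a ⊡ p)ⁱ = f₀ ⊡ pⁱ ⊡ aⁱ := by rw [O.inv_op, O.op_assoc]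
  have e₆ : a ⊡ w ⊡ h₁ = a ⊡ (w ⊡ h₁) := O.op_assoc _ _ _
  rw [e₃] at hfg ⊢
  rw [e₄] at hh ⊢
  rw [e₅] at hf ⊢
  rw [e₆] at hgh ⊢
  rw [star_cancel, star_cancel]
  exact hS'.star_eq hO hf.left hfg.left hh.right hgh.right

/-- Left translation does not change the quotient `c⁻¹ ⋆ a`. -/
lemma inv_star_star (hO : O.IsOre) {g a c : Y} (hg : O.Admissible g) (ha : O.Admissible a)
    (hc : O.Admissible c) : O.star (O.star g c)ⁱ (O.star g a) = O.star cⁱ a := by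
  rw [inv_star, star_assoc hO hc.inv hg.inv (hg.star hO ha), ← star_assoc hO hg.inv hg ha,
    star_inv_self, id_star]

/-! ### Medians -/

lemma IsJoin3G.unique {x y z j k : Y} (hj : O.IsJoin3G x y z j) (hk : O.IsJoin3G x y z k) :
    j = k :=
  O.le_antisymm _ _ (hj.2.2.2.2 _ hk.1 hk.2.1 hk.2.2.1 hk.2.2.2.1)
    (hk.2.2.2.2 _ hj.1 hj.2.1 hj.2.2.1 hj.2.2.2.1)

lemma jn3_eq {x y z j : Y} (h : O.IsJoin3G x y z j) : O.jn3 x y z = j := by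
  have h' : ∃ j, O.IsJoin3G x y z j := ⟨j, h⟩
  rw [jn3, dif_pos h']
  exact h'.choose_spec.unique h

lemma isJoin3G_med (hO : O.IsOre) {a b c : Y} (ha : O.Admissible a) (hb : O.Admissible b)
    (hc : O.Admissible c) :
    O.IsJoin3G (O.meet a b) (O.meet b c) (O.meet a c) (O.med a b c) := by
  obtain ⟨m, hm, -⟩ := hO.1 a b c ha hb hc
  rwa [med, jn3_eq hm]

/-- The median of `a`, `b`, `c` lies in the interval between `a` and `b`. -/
lemma IsJoin3G.med_eq {a b c m : Y}
    (hm : O.IsJoin3G (O.meet a b) (O.meet b c) (O.meet a c) m) : O.med a b m = m := by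
  obtain ⟨h₀, h₁, h₂, h₃, h⟩ := hm
  refine jn3_eq ⟨h₀, h₁, O.meet_le_right _ _, O.meet_le_right _ _, fun s hs hs₁ hs₂ hs₃ =>
    h s hs hs₁ (O.le_trans _ _ _ ?_ hs₂) (O.le_trans _ _ _ ?_ hs₃)⟩
  · exact O.le_meet _ _ _ (O.meet_le_left _ _) h₂
  · exact O.le_meet _ _ _ (O.meet_le_left _ _) h₃

lemma med_rotate (hO : O.IsOre) {a b c : Y} (ha : O.Admissible a) (hb : O.Admissible b)
    (hc : O.Admissible c) : O.med b c a = O.med a b c := by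
  obtain ⟨h₀, h₁, h₂, h₃, h⟩ := isJoin3G_med hO ha hb hc
  refine jn3_eq ⟨h₀, h₂, meet_comm (O := O) a c ▸ h₃, meet_comm (O := O) a b ▸ h₁,
    fun s hs hs₁ hs₂ hs₃ => h s hs (meet_comm (O := O) a b ▸ hs₃) hs₁
      (meet_comm (O := O) a c ▸ hs₂)⟩

lemma med_med_left (hO : O.IsOre) {a b c : Y} (ha : O.Admissible a) (hb : O.Admissible b)
    (hc : O.Admissible c) : O.med a b (O.med a b c) = O.med a b c :=
  (isJoin3G_med hO ha hb hc).med_eq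

lemma Admissible.med (hO : O.IsOre) {a b c : Y} (ha : O.Admissible a) (hb : O.Admissible b)
    (hc : O.Admissible c) : O.Admissible (O.med a b c) := (isJoin3G_med hO ha hb hc).1

/-- If `n` lies between `a` and `b`, then the part of `c` below `n` lies below the median. -/
lemma meet_le_med (hO : O.IsOre) {a b c n : Y} (ha : O.Admissible a) (hb : O.Admissible b)
    (hc : O.Admissible c) (hn : O.Admissible n) (h : O.med a b n = n) :
    O.meet c n ≼ O.med a b c := by
  have hm := isJoin3G_med hO ha hb hc
  obtain ⟨k, hk, hd⟩ := hO.1 a b n ha hb hn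
  have hkn : k = n := (jn3_eq hk).symm.trans h
  subst hkn
  have hle := O.meet_le_left c k
  have hj := hd _ (hc.of_le hle)
  refine O.le_trans _ _ _ (O.le_meet _ _ _ (O.le_refl _) (O.meet_le_right _ _))
    (hj.2.2.2.2 _ hm.1 ?_ ?_ ?_)
  · exact O.le_trans _ _ _ (O.meet_le_right _ _) hm.2.1
  · exact O.le_trans _ _ _ (O.le_meet _ _ _ (O.le_trans _ _ _ (O.meet_le_right _ _)
      (O.meet_le_left _ _)) (O.le_trans _ _ _ (O.meet_le_left _ _) hle)) hm.2.2.1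
  · exact O.le_trans _ _ _ (O.le_meet _ _ _ (O.le_trans _ _ _ (O.meet_le_right _ _)
      (O.meet_le_left _ _)) (O.le_trans _ _ _ (O.meet_le_left _ _) hle)) hm.2.2.2.1

/-- The median is the only element lying in all three intervals. -/
lemma eq_med (hO : O.IsOre) {a b c n : Y} (ha : O.Admissible a) (hb : O.Admissible b)
    (hc : O.Admissible c) (hn : O.Admissible n) (hab : O.med a b n = n) (hbc : O.med b c n = n)
    (hca : O.med c a n = n) : n = O.med a b c := by
  have j₁ := isJoin3G_med hO ha hb hn
  have j₂ := isJoin3G_med hO hb hc hn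
  have j₃ := isJoin3G_med hO hc ha hn
  have hm := isJoin3G_med hO ha hb hc
  rw [hab] at j₁
  rw [hbc] at j₂
  rw [hca] at j₃
  apply O.le_antisymm
  · refine j₁.2.2.2.2 _ hm.1 hm.2.1 ?_ ?_
    · rw [med_rotate hO hc ha hb]
      exact meet_le_med hO hc ha hb hn hca
    · rw [← med_rotate hO ha hb hc]
      exact meet_le_med hO hb hc ha hn hbc
  · exact hm.2.2.2.2 _ hn j₁.2.1 j₂.2.1 (meet_comm (O := O) c a ▸ j₃.2.1)

/-- An element `c` lies between `a` and `b` iff the quotients `c⁻¹ ⋆ a` and `c⁻¹ ⋆ b` are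
coprime. -/
lemma meet_star_eq_id_iff (hO : O.IsOre) {a b c : Y} (ha : O.Admissible a) (hb : O.Admissible b)
    (hc : O.Admissible c) :
    O.meet (O.star cⁱ a) (O.star cⁱ b) = 𝟙₀ ↔ O.med a b c = c := by
  rw [← cop_iff_meet]
  obtain ⟨c₁, a₁, hca, hac, hc₁⟩ := exists_meet_factor (O := O) c a
  obtain ⟨c₂, b₁, hcb, hbc, hc₂⟩ := exists_meet_factor (O := O) c b
  obtain ⟨p, q, hp, hq, hpq⟩ := exists_meet_factor (O := O) (O.meet c a) (O.meet c b)
  have hm := isJoin3G_med hO ha hb hc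
  rw [meet_comm a c, meet_comm b c] at hm
  have hmc := O.meet_le_left c a
  have hmc' := O.meet_le_left c b
  set P := O.meet c a
  set Q := O.meet c b
  set k := O.meet P Q
  have hsa : O.star cⁱ a = c₁ⁱ ⊡ a₁ := by
    rw [hac]
    conv_lhs => rw [hca, O.inv_op]
    exact star_of_cop (by rwa [O.inv_invol])
  have hsb : O.star cⁱ b = c₂ⁱ ⊡ b₁ := by
    rw [hbc]
    conv_lhs => rw [hcb, O.inv_op]
    exact star_of_cop (by rwa [O.inv_invol])
  rw [hsa, hsb]
  have hcomm : p ⊡ c₁ = q ⊡ c₂ := O.cancel_left k _ _ (by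
    rw [← O.op_assoc, ← O.op_assoc, ← hp, ← hq, ← hca, ← hcb])
  have hkc : c = k ⊡ (p ⊡ c₁) := by rw [← O.op_assoc, ← hp, ← hca]
  have hadm : O.Admissible (p ⊡ c₁) := (hkc ▸ hc : O.Admissible (k ⊡ (p ⊡ c₁))).right
  have hpa : O.Admissible (p ⊡ a₁) := by
    rw [hac, hp, O.op_assoc] at ha; exact ha.right
  have hqb : O.Admissible (q ⊡ b₁) := by
    rw [hbc, hq, O.op_assoc] at hb; exact hb.right
  have hak : a = k ⊡ (p ⊡ a₁) := by rw [← O.op_assoc, ← hp, ← hac]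
  have hbk : b = k ⊡ (q ⊡ b₁) := by rw [← O.op_assoc, ← hq, ← hbc]
  constructor
  · intro h
    have hS : O.Sq p q c₂ c₁ := Sq.of_cop hO hadm.left (hcomm ▸ hadm).left hcomm hpq
      (h.symm.mono (le_op_s13 _ _) (le_op_s13 _ _))
    have hS' : O.Sq p q c₂ⁱⁱ c₁ⁱⁱ := by rwa [O.inv_invol, O.inv_invol]
    have hcop : O.Cop (p ⊡ a₁) (q ⊡ b₁) := by
      intro z hz₁ hz₂
      obtain ⟨d, F, e, H, R, U, V, β, γ, rfl, rfl, -, -, hγ, hβ, -, hR⟩ :=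
        hS.exists_transport hO hpa.right hqb.right hc₁ hc₂ hz₁ hz₂
      refine hR (h R ?_ ?_)
      · rw [← O.op_assoc, hγ, O.op_assoc]; exact le_op_s13 _ _
      · rw [← O.op_assoc, hβ, O.op_assoc]; exact le_op_s13 _ _
    have hab : O.meet a b = k := by
      conv_lhs => rw [hak, hbk]
      exact meet_op_op hcop
    refine jn3_eq ⟨hc, ?_, O.meet_le_right _ _, O.meet_le_right _ _, fun s _ _ hs₂ hs₃ => ?_⟩
    · rw [hab, hkc]; exact le_op_s13 _ _
    · rw [meet_comm b c] at hs₂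
      rw [meet_comm a c] at hs₃
      rw [hkc]
      obtain ⟨s', rfl⟩ := exists_of_le (O.le_trans _ _ _ (O.meet_le_left P Q) hs₃)
      refine op_le_op_iff.2 (hS.isJoin.2.2 _ ?_ ?_)
      · rwa [← op_le_op_iff (a := k), ← hp]
      · rwa [← op_le_op_iff (a := k), ← hq]
  · intro h
    rw [h] at hm
    have hab : O.meet a b ≼ k := O.le_meet _ _ _
      (O.le_meet _ _ _ hm.2.1 (O.meet_le_left _ _))
      (O.le_meet _ _ _ hm.2.1 (O.meet_le_right _ _))
    have hcop : O.Cop (p ⊡ a₁) (q ⊡ b₁) := by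
      intro z hz₁ hz₂
      refine eq_id_of_op_le (x := k) (O.le_trans _ _ _ (O.le_meet _ _ _ ?_ ?_) hab)
      · rw [hak]; exact op_le_op_iff.2 hz₁
      · rw [hbk]; exact op_le_op_iff.2 hz₂
    have htop : O.Cop c₂ⁱ c₁ⁱ := by
      refine cop_of_isJoin hcomm ⟨le_op_s13 _ _, hcomm ▸ le_op_s13 _ _, fun s hs₁ hs₂ => ?_⟩
      have hs : O.meet (p ⊡ c₁) s ≼ p ⊡ c₁ := O.meet_le_left _ _
      refine O.le_trans _ _ _ ?_ (O.meet_le_right (p ⊡ c₁) s)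
      rw [← op_le_op_iff (a := k), ← hkc]
      refine hm.2.2.2.2 _ (hc.of_le ?_) (O.le_trans _ _ _ hab (le_op_s13 _ _)) ?_ ?_
      · conv_rhs => rw [hkc]
        exact op_le_op_iff.2 hs
      · rw [hq]; exact op_le_op_iff.2 (O.le_meet _ _ _ (hcomm ▸ le_op_s13 _ _) hs₂)
      · rw [hp]; exact op_le_op_iff.2 (O.le_meet _ _ _ (le_op_s13 _ _) hs₁)
    have hS : O.Sq c₁ⁱ c₂ⁱ qⁱ pⁱ :=
      (Sq.of_cop hO hadm.left (hcomm ▸ hadm).left hcomm hpq htop).symm.rotate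
    intro z hz₁ hz₂
    obtain ⟨d, F, e, H, R, U, V, β, γ, rfl, rfl, -, -, hγ, hβ, -, hR⟩ :=
      hS.exists_transport hO hpa.right hqb.right hpa.cop hqb.cop hz₁ hz₂
    rw [O.inv_invol] at hγ hβ
    refine hR (hcop R ?_ ?_)
    · rw [← O.op_assoc, hγ, O.op_assoc]; exact le_op_s13 _ _
    · rw [← O.op_assoc, hβ, O.op_assoc]; exact le_op_s13 _ _

lemma med_star (hO : O.IsOre) {g a b m : Y} (hg : O.Admissible g) (ha : O.Admissible a)
    (hb : O.Admissible b) (hm : O.Admissible m) (h : O.med a b m = m) :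
    O.med (O.star g a) (O.star g b) (O.star g m) = O.star g m := by
  rw [← meet_star_eq_id_iff hO (hg.star hO ha) (hg.star hO hb) (hg.star hO hm),
    inv_star_star hO hg ha hm, inv_star_star hO hg hb hm, meet_star_eq_id_iff hO ha hb hm, h]

end Theory

end OreData

/-- For admissible `a, b, c`: `(c⁻¹ ⋆ a) ∧ (c⁻¹ ⋆ b) = id` iff `m(a,b,c) = c`; that is,
`I(a,b) = {c ∈ G : m(a,b,c) = c}`. Consequently, left ⋆-multiplication is median
preserving. -/
theorem stmt13 {Y : Type} (O : OreData Y) (hO : O.IsOre) :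
    (∀ a b c : Y, O.Admissible a → O.Admissible b → O.Admissible c →
      (O.meet (O.star (O.inv c) a) (O.star (O.inv c) b) = O.idY ↔ O.med a b c = c)) ∧
    (∀ g a b c : Y, O.Admissible g → O.Admissible a → O.Admissible b → O.Admissible c →
      O.star g (O.med a b c) = O.med (O.star g a) (O.star g b) (O.star g c)) := by
  refine ⟨fun a b c ha hb hc => OreData.meet_star_eq_id_iff hO ha hb hc,
    fun g a b c hg ha hb hc => ?_⟩
  have hm := ha.med hO hb hc
  refine OreData.eq_med hO (hg.star hO ha) (hg.star hO hb) (hg.star hO hc) (hg.star hO hm)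
    (OreData.med_star hO hg ha hb hm (OreData.med_med_left hO ha hb hc))
    (OreData.med_star hO hg hb hc hm ?_) (OreData.med_star hO hg hc ha hm ?_)
  · rw [← OreData.med_rotate hO ha hb hc]
    exact OreData.med_med_left hO hb hc ha
  · rw [OreData.med_rotate hO hc ha hb]
    exact OreData.med_med_left hO hc ha hb
end
end
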